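/- Let A = ℂQ/⟨R⟩ be an acyclic bound quiver algebra and α ∈ ℕ^{Q_0} a dimension vector such that P_A(α) ≠ ∅. Assume that C(α) is an orbit closure, say C(α) = closure(GL(α)·V) for some V ∈ P_A(α). Then Ext^1_A(V,V) = 0; in particular ext^1_A(C(α), C(α)) = 0. -/

import Mathlib

open Matrix
noncomputable section

/-- A (finite-vertex) quiver: vertices, arrows, tail and head maps. -/
structure Quiv where
  V : Type
  A : Type
  t : A → V
  h : A → V
  [fV : Fintype V]
  [dV : DecidableEq V]

attribute [instance] Quiv.fV Quiv.dV

/-- The `Quiver` structure on the vertices of `Q`: an arrow from `x` to `y` is an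
arrow of `Q` with tail `x` and head `y`.  This gives us `Quiver.Path x y`, the type of
oriented paths from `x` to `y` in `Q`. -/
instance quivToQuiver (Q : Quiv) : Quiver Q.V := ⟨fun x y => {a : Q.A // Q.t a = x ∧ Q.h a = y}⟩

/-- The space of matrix representations of `Q` of dimension vector `β`, with entries in a
commutative ring `R`. -/
def RepR (Q : Quiv) (R : Type) (β : Q.V → ℕ) := ∀ a : Q.A, Matrix (Fin (β (Q.h a))) (Fin (β (Q.t a))) R

/-- The representation space `rep(Q,β) = ∏_{a ∈ Q₁} ℂ^{β(ha) × β(ta)}`. -/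
abbrev QRep (Q : Quiv) (β : Q.V → ℕ) := RepR Q ℂ β

/-- Transport of a rectangular matrix along equalities of its sizes. -/
def castM {R : Type} {m n m' n' : ℕ} (hm : m = m') (hn : n = n')
    (M : Matrix (Fin m) (Fin n) R) : Matrix (Fin m') (Fin n') R :=
  M.submatrix (Fin.cast hm.symm) (Fin.cast hn.symm)

/-- The value `W(p)` of a representation `W` on an oriented path `p` (the product of the
matrices attached to the arrows of `p`; the trivial path gives the identity matrix). -/
def evalPath {Q : Quiv} {R : Type} [CommRing R] {β : Q.V → ℕ} (W : RepR Q R β) :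
    ∀ {x y : Q.V}, Quiver.Path x y → Matrix (Fin (β y)) (Fin (β x)) R
  | _, _, Quiver.Path.nil => 1
  | _, _, Quiver.Path.cons p e =>
      (castM (congrArg β e.2.2) (congrArg β e.2.1) (W e.1)) * evalPath W p
variable (Q : Quiv)

/-- A formal (finite) linear combination of parallel oriented paths in `Q`, together with its
endpoints: the element of the path algebra it represents lives in `e_y · ℂQ · e_x`. -/
def FormalRel := Σ (x : Q.V) (y : Q.V), (Quiver.Path x y →₀ ℂ)

variable {Q}

/-- Evaluation of a representation on a formal linear combination of parallel paths. -/
def evalLin {β : Q.V → ℕ} (W : QRep Q β) {x y : Q.V} (c : Quiver.Path x y →₀ ℂ) :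
    Matrix (Fin (β y)) (Fin (β x)) ℂ :=
  c.sum fun p k => k • evalPath W p

/-- Evaluation of a representation over `ℂ[x]` on a formal linear combination of paths. -/
def evalLinP {β : Q.V → ℕ} (W : RepR Q (Polynomial ℂ) β) {x y : Q.V}
    (c : Quiver.Path x y →₀ ℂ) : Matrix (Fin (β y)) (Fin (β x)) (Polynomial ℂ) :=
  c.sum fun p k => (Polynomial.C k) • evalPath W p

/-- The module variety `mod(A,β)` of the algebra `A = ℂQ/⟨S⟩`: all `β`-dimensional
representations of `Q` annihilating every relation in `S`. -/
def modSet (S : Set (FormalRel Q)) (β : Q.V → ℕ) : Set (QRep Q β) :=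
  {W | ∀ r ∈ S, evalLin W r.2.2 = 0}

/-- A set of relations is admissible if every path occurring in it has length at least two. -/
def AdmissibleRels (S : Set (FormalRel Q)) : Prop :=
  ∀ r ∈ S, ∀ p ∈ r.2.2.support, 2 ≤ p.length

/-- The base change group `GL(β) = ∏_x GL(β(x),ℂ)`. -/
abbrev GLb (β : Q.V → ℕ) := ∀ x : Q.V, Matrix.GeneralLinearGroup (Fin (β x)) ℂ

/-- The action of `GL(β)` on `rep(Q,β)` by simultaneous conjugation. -/
def gAct {β : Q.V → ℕ} (g : GLb β) (W : QRep Q β) : QRep Q β :=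
  fun a => ((g (Q.h a)).val) * W a * (((g (Q.t a))⁻¹).val)

/-- The character of `GL(β)` induced by the weight `σ`: `g ↦ ∏_x det(g(x))^{σ(x)}`.  -/
def chi {β : Q.V → ℕ} (σ : Q.V → ℤ) (g : GLb β) : ℂ :=
  ∏ x : Q.V, ((g x).val.det) ^ (σ x)

/-- Index type of the coordinates on `rep(Q,β)`. -/
def RepCoord (β : Q.V → ℕ) := Σ a : Q.A, Fin (β (Q.h a)) × Fin (β (Q.t a))

/-- The coordinates of a point of `rep(Q,β)`. -/
def repCoords {β : Q.V → ℕ} (W : QRep Q β) : RepCoord (Q := Q) β → ℂ :=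
  fun c => W c.1 c.2.1 c.2.2

/-- `F` is a polynomial function on `rep(Q,β)`. -/
def IsPolyFun {β : Q.V → ℕ} (F : QRep Q β → ℂ) : Prop :=
  ∃ P : MvPolynomial (RepCoord (Q := Q) β) ℂ, ∀ W, F W = MvPolynomial.eval (repCoords W) P

/-- `F` is a semi-invariant of weight `σ` on `rep(Q,β)`. -/
def IsSemiInvariant {β : Q.V → ℕ} (σ : Q.V → ℤ) (F : QRep Q β → ℂ) : Prop :=
  IsPolyFun F ∧ ∀ (g : GLb β) (W : QRep Q β), F (gAct g W) = chi σ g * F W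

/-- The orbit semigroup `S_Q(W)` of a representation `W ∈ rep(Q,β)`: all weights `σ` admitting
a semi-invariant of weight `σ` not vanishing at `W`. -/
def OrbitSemigroup {β : Q.V → ℕ} (W : QRep Q β) : Set (Q.V → ℤ) :=
  {σ | ∃ F : QRep Q β → ℂ, IsSemiInvariant σ F ∧ F W ≠ 0}

/-- `W` is `σ`-semi-stable: some positive multiple of `σ` lies in the orbit semigroup. -/
def SemiStable {β : Q.V → ℕ} (σ : Q.V → ℤ) (W : QRep Q β) : Prop :=
  ∃ n : ℕ, 1 ≤ n ∧ (fun x => (n : ℤ) * σ x) ∈ OrbitSemigroup W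

/-- The weight `σ` is `W`-saturated: if `nσ` lies in the orbit semigroup of `W` for some
integer `n ≥ 1`, then so does `σ`. -/
def WSaturated {β : Q.V → ℕ} (W : QRep Q β) (σ : Q.V → ℤ) : Prop :=
  (∃ n : ℕ, 1 ≤ n ∧ (fun x => (n : ℤ) * σ x) ∈ OrbitSemigroup W) → σ ∈ OrbitSemigroup W

/-- `Q` is connected: any two vertices are joined by an unoriented walk. -/
def QConnected (Q : Quiv) : Prop :=
  ∀ x y : Q.V, Relation.ReflTransGen
    (fun u v => ∃ a : Q.A, (Q.t a = u ∧ Q.h a = v) ∨ (Q.t a = v ∧ Q.h a = u)) x y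

/-- `Q` is acyclic: the only oriented path from a vertex to itself is the trivial one. -/
def QAcyclic (Q : Quiv) : Prop := ∀ (x : Q.V) (p : Quiver.Path x x), p = Quiver.Path.nil
section Capacity

variable (Q : Quiv) (β : Q.V → ℕ) (σ : Q.V → ℤ)

/-- Vertices where the weight `σ` is positive. -/
abbrev PosV := {x : Q.V // 0 < σ x}

/-- Vertices where the weight `σ` is negative. -/
abbrev NegV := {x : Q.V // σ x < 0}

/-- `σ₊` at a positive vertex. -/
abbrev posP (i : PosV Q σ) : ℕ := (σ i.1).toNat

/-- `σ₋` at a negative vertex. -/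
abbrev negP (j : NegV Q σ) : ℕ := (-σ j.1).toNat

/-- Row index type of the `N × N` block matrices: block rows are indexed by pairs `(j,q)`
with `q ∈ I_j⁻`, each of height `β(w_j)`; so `N = Σ_j σ₋(w_j)β(w_j)` rows in total. -/
abbrev RowT := Σ j : NegV Q σ, Fin (negP Q σ j) × Fin (β j.1)

/-- Column index type of the `N × N` block matrices: block columns indexed by pairs `(i,r)`
with `r ∈ I_i⁺`, each of width `β(v_i)`; so `N = Σ_i σ₊(v_i)β(v_i)` columns in total. -/
abbrev ColT := Σ i : PosV Q σ, Fin (posP Q σ i) × Fin (β i.1)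

/-- The index set `I_σ = {(i,j,p,q,r)}`. -/
structure BIdx where
  i : PosV Q σ
  j : NegV Q σ
  p : Quiver.Path i.1 j.1
  q : Fin (negP Q σ j)
  r : Fin (posP Q σ i)

variable {Q β σ}

/-- The block matrix `W^{i,j,p}_{q,r}`: its `(q,r)` block entry is `W(p)` and all other
entries vanish. -/
def blockMat (W : QRep Q β) (d : BIdx Q σ) : Matrix (RowT Q β σ) (ColT Q β σ) ℂ :=
  fun s u =>
    if hj : s.1 = d.j then
      if hi : u.1 = d.i then
        if Fin.cast (congrArg (negP Q σ) hj) s.2.1 = d.q ∧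
           Fin.cast (congrArg (posP Q σ) hi) u.2.1 = d.r then
          evalPath W d.p (Fin.cast (congrArg (fun z => β z.1) hj) s.2.2)
            (Fin.cast (congrArg (fun z => β z.1) hi) u.2.2)
        else 0
      else 0
    else 0

/-- The Brascamp–Lieb (completely positive) operator `T_{W,σ}` associated to the quiver
datum `(W,σ)`, with Kraus operators the block matrices `W^{i,j,p}_{q,r}`. -/
def BLop (W : QRep Q β) (X : Matrix (RowT Q β σ) (RowT Q β σ) ℂ) :
    Matrix (ColT Q β σ) (ColT Q β σ) ℂ :=
  ∑ᶠ d : BIdx Q σ, (blockMat W d)ᵀ * X * blockMat W d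

/-- The capacity `cap_Q(W,σ)` of the quiver datum `(W,σ)`: the infimum of
`Det (T_{W,σ}(X))` over real positive definite matrices `X` with `Det X = 1`. -/
def capQ (W : QRep Q β) : ℝ :=
  sInf {r : ℝ | ∃ X : Matrix (RowT Q β σ) (RowT Q β σ) ℝ, X.PosDef ∧ X.det = 1 ∧
    r = ((BLop (σ := σ) W (X.map Complex.ofReal)).det).re}

/-- `Span_ℂ(W^{i,j,p}_{q,r} : (i,j,p,q,r) ∈ I_σ)` contains a non-singular `N × N` matrix. -/
def SpanNonsingular (W : QRep Q β) (σ : Q.V → ℤ) : Prop :=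
  ∃ M ∈ Submodule.span ℂ (Set.range (blockMat (σ := σ) W)),
    Function.Bijective (Matrix.mulVecLin M)

end Capacity
section HomExt

variable {Q : Quiv}

/-- The space of morphisms of representations `Hom(V,W)`, as a subspace of
`∏_x Hom(V(x),W(x))` (in matrix form). -/
def HomS {α γ : Q.V → ℕ} (V : QRep Q α) (W : QRep Q γ) :
    Submodule ℂ (∀ x : Q.V, Matrix (Fin (γ x)) (Fin (α x)) ℂ) where
  carrier := {φ | ∀ a : Q.A, φ (Q.h a) * V a = W a * φ (Q.t a)}
  add_mem' := by
    intro φ ψ hφ hψ a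
    simp only [Pi.add_apply, Matrix.add_mul, Matrix.mul_add, hφ a, hψ a]
  zero_mem' := by intro a; simp
  smul_mem' := by
    intro c φ hφ a
    simp only [Pi.smul_apply, Matrix.smul_mul, Matrix.mul_smul, hφ a]

/-- `dim_ℂ Hom(V,W)`. -/
def dimHom {α γ : Q.V → ℕ} (V : QRep Q α) (W : QRep Q γ) : ℕ :=
  Module.finrank ℂ (HomS V W)

/-- A family of matrices is componentwise surjective (as linear maps). -/
def MorSurj {α γ : Q.V → ℕ} (φ : ∀ x : Q.V, Matrix (Fin (γ x)) (Fin (α x)) ℂ) : Prop :=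
  ∀ x, Function.Surjective (Matrix.mulVecLin (φ x))

/-- A family of matrices is componentwise injective (as linear maps). -/
def MorInj {α γ : Q.V → ℕ} (φ : ∀ x : Q.V, Matrix (Fin (γ x)) (Fin (α x)) ℂ) : Prop :=
  ∀ x, Function.Injective (Matrix.mulVecLin (φ x))

/-- Isomorphism of representations (possibly of different dimension vectors). -/
def RIso {α γ : Q.V → ℕ} (V : QRep Q α) (W : QRep Q γ) : Prop :=
  ∃ u : ∀ x : Q.V, ((Fin (α x) → ℂ) ≃ₗ[ℂ] (Fin (γ x) → ℂ)),
    ∀ a : Q.A, (u (Q.h a)).toLinearMap ∘ₗ (V a).mulVecLin =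
      (W a).mulVecLin ∘ₗ (u (Q.t a)).toLinearMap

/-- The space of `1`-cochains from `V` to `W`: families `φ(a) : V(ta) → W(ha)`. -/
abbrev C1sp (α γ : Q.V → ℕ) := ∀ a : Q.A, Matrix (Fin (γ (Q.h a))) (Fin (α (Q.t a))) ℂ

/-- The derivative (Leibniz rule) of a path with respect to a `1`-cochain `φ`:
`D_{a_s ⋯ a_1}(φ) = Σ_k W(a_s ⋯ a_{k+1}) φ(a_k) V(a_{k-1} ⋯ a_1)`. -/
def der {α γ : Q.V → ℕ} (V : QRep Q α) (W : QRep Q γ) (φ : C1sp (Q := Q) α γ) :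
    ∀ {x y : Q.V}, Quiver.Path x y → Matrix (Fin (γ y)) (Fin (α x)) ℂ
  | _, _, Quiver.Path.nil => 0
  | _, _, Quiver.Path.cons p e =>
      castM (congrArg γ e.2.2) (congrArg α e.2.1) (φ e.1) * evalPath V p
      + castM (congrArg γ e.2.2) (congrArg γ e.2.1) (W e.1) * der V W φ p

lemma der_add {α γ : Q.V → ℕ} (V : QRep Q α) (W : QRep Q γ) (φ ψ : C1sp (Q := Q) α γ)
    {x y : Q.V} (p : Quiver.Path x y) :
    der V W (φ + ψ) p = der V W φ p + der V W ψ p := by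
  induction p with
  | nil => simp [der]
  | cons p e ih =>
      simp only [der, ih, Pi.add_apply, castM, Matrix.submatrix_add, Matrix.add_mul,
        Matrix.mul_add]
      abel

lemma der_smul {α γ : Q.V → ℕ} (V : QRep Q α) (W : QRep Q γ) (c : ℂ) (φ : C1sp (Q := Q) α γ)
    {x y : Q.V} (p : Quiver.Path x y) :
    der V W (c • φ) p = c • der V W φ p := by
  induction p with
  | nil => simp [der]
  | cons p e ih =>
      simp only [der, ih, Pi.smul_apply, castM, Matrix.submatrix_smul, Matrix.smul_mul,
        Matrix.mul_smul, smul_add]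

lemma der_zero {α γ : Q.V → ℕ} (V : QRep Q α) (W : QRep Q γ)
    {x y : Q.V} (p : Quiver.Path x y) :
    der V W (0 : C1sp (Q := Q) α γ) p = 0 := by
  induction p with
  | nil => simp [der]
  | cons p e ih =>
      simp [der, ih, castM]

/-- The derivative of a formal linear combination of parallel paths. -/
def derRel {α γ : Q.V → ℕ} (V : QRep Q α) (W : QRep Q γ) (φ : C1sp (Q := Q) α γ)
    {x y : Q.V} (c : Quiver.Path x y →₀ ℂ) : Matrix (Fin (γ y)) (Fin (α x)) ℂ :=
  c.sum fun p k => k • der V W φ p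

/-- The space of `1`-cocycles relative to the set of relations `S`: cochains whose
derivative kills every relation in `S`. -/
def Z1 (S : Set (FormalRel Q)) {α γ : Q.V → ℕ} (V : QRep Q α) (W : QRep Q γ) :
    Submodule ℂ (C1sp (Q := Q) α γ) where
  carrier := {φ | ∀ r ∈ S, derRel V W φ r.2.2 = 0}
  add_mem' := by
    intro φ ψ hφ hψ r hr
    have : derRel V W (φ + ψ) r.2.2 = derRel V W φ r.2.2 + derRel V W ψ r.2.2 := by
      simp only [derRel, der_add, smul_add]
      exact Finsupp.sum_add
    rw [this, hφ r hr, hψ r hr, add_zero]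
  zero_mem' := by
    intro r hr
    simp [derRel, der_zero]
  smul_mem' := by
    intro c φ hφ r hr
    have : derRel V W (c • φ) r.2.2 = c • derRel V W φ r.2.2 := by
      simp only [derRel, der_smul, Finsupp.smul_sum, smul_comm c]
    rw [this, hφ r hr, smul_zero]

/-- The coboundary map `d⁰ : ∏_x Hom(V(x),W(x)) → C¹`,
`f ↦ (a ↦ f(ha) V(a) − W(a) f(ta))`. -/
def d0map {α γ : Q.V → ℕ} (V : QRep Q α) (W : QRep Q γ) :
    (∀ x : Q.V, Matrix (Fin (γ x)) (Fin (α x)) ℂ) →ₗ[ℂ] C1sp (Q := Q) α γ where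
  toFun f := fun a => f (Q.h a) * V a - W a * f (Q.t a)
  map_add' f g := by
    funext a
    simp only [Pi.add_apply, Matrix.add_mul, Matrix.mul_add]
    abel
  map_smul' c f := by
    funext a
    simp only [Pi.smul_apply, Matrix.smul_mul, Matrix.mul_smul, smul_sub, RingHom.id_apply]

/-- The space of `1`-coboundaries. -/
def B1 {α γ : Q.V → ℕ} (V : QRep Q α) (W : QRep Q γ) : Submodule ℂ (C1sp (Q := Q) α γ) :=
  LinearMap.range (d0map V W)

/-- `dim_ℂ Ext¹(V,W)` over the algebra `ℂQ/⟨S⟩`, computed as the dimension of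
`Z¹/B¹` (for modules, `B¹ ⊆ Z¹`, so this is `dim Z¹ − dim B¹`). -/
def dimExt1 (S : Set (FormalRel Q)) {α γ : Q.V → ℕ} (V : QRep Q α) (W : QRep Q γ) : ℕ :=
  Module.finrank ℂ (Z1 S V W) - Module.finrank ℂ ↥((B1 V W) ⊓ (Z1 S V W))

end HomExt
section ProjPdim

variable {Q : Quiv}

/-- `P` is a projective module over `ℂQ/⟨S⟩` (in matrix-representation form):
every morphism from `P` to the target of a surjection of modules lifts. -/
def IsProjRep (S : Set (FormalRel Q)) {γ : Q.V → ℕ} (P : QRep Q γ) : Prop :=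
  ∀ (δ ε : Q.V → ℕ) (M : QRep Q δ) (N : QRep Q ε), M ∈ modSet S δ → N ∈ modSet S ε →
    ∀ g ∈ HomS M N, MorSurj g → ∀ f ∈ HomS P N,
      ∃ h ∈ HomS P M, ∀ x, g x * h x = f x

/-- `V` has projective dimension at most one over `ℂQ/⟨S⟩`: there is a short exact
sequence `0 → P₁ → P₀ → V → 0` with `P₀, P₁` projective. -/
def PdimLE1 (S : Set (FormalRel Q)) {β : Q.V → ℕ} (V : QRep Q β) : Prop :=
  ∃ (γ₀ γ₁ : Q.V → ℕ) (P₀ : QRep Q γ₀) (P₁ : QRep Q γ₁),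
    P₀ ∈ modSet S γ₀ ∧ P₁ ∈ modSet S γ₁ ∧ IsProjRep S P₀ ∧ IsProjRep S P₁ ∧
    ∃ i ∈ HomS P₁ P₀, ∃ p ∈ HomS P₀ V, MorInj i ∧ MorSurj p ∧
      ∀ x, LinearMap.range (Matrix.mulVecLin (i x)) = LinearMap.ker (Matrix.mulVecLin (p x))

/-- The set `P_A(α) = {V ∈ mod(A,α) : pdim_A V ≤ 1}` where `A = ℂQ/⟨S⟩`. -/
def PAset (S : Set (FormalRel Q)) (α : Q.V → ℕ) : Set (QRep Q α) :=
  {V | V ∈ modSet S α ∧ PdimLE1 S V}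

end ProjPdim

section Zariski

/-- The Zariski topology on the affine space `ι → ℂ`: generated by the complements of
hypersurfaces. -/
def zarPi (ι : Type) : TopologicalSpace (ι → ℂ) :=
  TopologicalSpace.generateFrom
    {U | ∃ p : MvPolynomial ι ℂ, U = {w | MvPolynomial.eval w p ≠ 0}}

variable {Q : Quiv}

/-- The Zariski topology on `rep(Q,β)`. -/
def zarTop (β : Q.V → ℕ) : TopologicalSpace (QRep Q β) :=
  TopologicalSpace.induced (repCoords (β := β)) (zarPi _)

/-- Zariski closure in `rep(Q,β)`. -/
def zclosure {β : Q.V → ℕ} (s : Set (QRep Q β)) : Set (QRep Q β) :=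
  @closure _ (zarTop β) s

/-- Zariski-open. -/
def zIsOpen {β : Q.V → ℕ} (s : Set (QRep Q β)) : Prop := @IsOpen _ (zarTop β) s

/-- Zariski-closed. -/
def zIsClosed {β : Q.V → ℕ} (s : Set (QRep Q β)) : Prop := @IsClosed _ (zarTop β) s

/-- Irreducibility in the Zariski topology. -/
def zIrred {β : Q.V → ℕ} (s : Set (QRep Q β)) : Prop := @IsIrreducible _ (zarTop β) s

/-- Dimension of a subset of `rep(Q,β)`: the topological Krull dimension in the
(subspace) Zariski topology. -/
def zdim {β : Q.V → ℕ} (s : Set (QRep Q β)) : WithBot ℕ∞ :=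
  @topologicalKrullDim s (TopologicalSpace.induced Subtype.val (zarTop β))

/-- `C(α)`: the closure of `P_A(α)`. -/
def Cset (S : Set (FormalRel Q)) (α : Q.V → ℕ) : Set (QRep Q α) := zclosure (PAset S α)

/-- `C` is an irreducible component of `M` (for `M` closed in `rep(Q,α)`): a maximal
irreducible closed subset of `M`. -/
def IsIrrCompOf {β : Q.V → ℕ} (C M : Set (QRep Q β)) : Prop :=
  zIrred C ∧ zIsClosed C ∧ C ⊆ M ∧
    ∀ C' : Set (QRep Q β), zIrred C' → zIsClosed C' → C' ⊆ M → C ⊆ C' → C' = C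

/-- `V` is an indecomposable representation: it is nonzero and its endomorphism algebra
has no idempotents other than `0` and `1`. -/
def IsIndecRep {α : Q.V → ℕ} (V : QRep Q α) : Prop :=
  (∃ x, α x ≠ 0) ∧
  ∀ φ ∈ HomS V V, (∀ x, φ x * φ x = φ x) → φ = 0 ∨ φ = fun x => (1 : Matrix _ _ ℂ)

/-- `C` is an indecomposable irreducible component of `M`: an irreducible component
containing a dense open subset of indecomposable representations. -/
def IsIndecComp {β : Q.V → ℕ} (C M : Set (QRep Q β)) : Prop :=
  IsIrrCompOf C M ∧
  ∃ U : Set (QRep Q β), zIsOpen U ∧ C ⊆ zclosure (C ∩ U) ∧ ∀ V ∈ C ∩ U, IsIndecRep V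

/-- The `GL(α)`-orbit of `V`. -/
def orbitOf {α : Q.V → ℕ} (V : QRep Q α) : Set (QRep Q α) := {W | ∃ g : GLb α, gAct g V = W}

/-- `C` is an orbit closure `closure(GL(α)·V)` of some module `V ∈ mod(A,α)`. -/
def IsOrbitClosure (S : Set (FormalRel Q)) {α : Q.V → ℕ} (C : Set (QRep Q α)) : Prop :=
  ∃ V ∈ modSet S α, C = zclosure (orbitOf V)

/-- The coordinates on `∏_x ℂ^{α(x) × α(x)}`, the ambient space of `GL(α)`. -/
def glCoords {α : Q.V → ℕ} (g : ∀ x : Q.V, Matrix (Fin (α x)) (Fin (α x)) ℂ) :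
    (Σ x : Q.V, Fin (α x) × Fin (α x)) → ℂ := fun c => g c.1 c.2.1 c.2.2

/-- The Zariski topology on `∏_x ℂ^{α(x) × α(x)}`. -/
def glTop (Q : Quiv) (α : Q.V → ℕ) :
    TopologicalSpace (∀ x : Q.V, Matrix (Fin (α x)) (Fin (α x)) ℂ) :=
  TopologicalSpace.induced glCoords (zarPi _)

/-- `GL(α)` as a (quasi-affine) subset of `∏_x ℂ^{α(x) × α(x)}`. -/
def glSet (Q : Quiv) (α : Q.V → ℕ) : Set (∀ x : Q.V, Matrix (Fin (α x)) (Fin (α x)) ℂ) :=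
  {g | ∀ x, IsUnit (g x)}

/-- The dimension of the group variety `GL(α)`. -/
def glDim (Q : Quiv) (α : Q.V → ℕ) : WithBot ℕ∞ :=
  @topologicalKrullDim (glSet Q α) (TopologicalSpace.induced Subtype.val (glTop Q α))

end Zariski
section Sums

variable {Q : Quiv}

/-- `W` is a direct sum of the representations `V i` (up to isomorphism of the underlying
block-diagonal structure). -/
def IsSumOf {ι : Type} [Fintype ι] [DecidableEq ι] {αs : ι → Q.V → ℕ} {δ : Q.V → ℕ}
    (W : QRep Q δ) (V : ∀ i, QRep Q (αs i)) : Prop :=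
  ∃ u : ∀ x : Q.V, ((Fin (δ x) → ℂ) ≃ₗ[ℂ] ((Σ i, Fin (αs i x)) → ℂ)),
    ∀ a : Q.A, (u (Q.h a)).toLinearMap ∘ₗ (W a).mulVecLin =
      (Matrix.blockDiagonal' (fun i => V i a)).mulVecLin ∘ₗ (u (Q.t a)).toLinearMap

/-- The constructible subset `C₁ ⊕ ⋯ ⊕ C_l ⊆ rep(Q,δ)`: representations isomorphic to a
direct sum `V₁ ⊕ ⋯ ⊕ V_l` with `V_i ∈ C_i`. -/
def sumSet {ι : Type} [Fintype ι] [DecidableEq ι] (αs : ι → Q.V → ℕ)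
    (Cs : ∀ i, Set (QRep Q (αs i))) (δ : Q.V → ℕ) : Set (QRep Q δ) :=
  {W | ∃ V : ∀ i, QRep Q (αs i), (∀ i, V i ∈ Cs i) ∧ IsSumOf W V}

/-- The generic `Ext¹` between two subsets:
`ext¹(C,D) = min {dim Ext¹(X,Y) : (X,Y) ∈ C × D}`. -/
def genExt1 (S : Set (FormalRel Q)) {α α' : Q.V → ℕ}
    (C : Set (QRep Q α)) (D : Set (QRep Q α')) : ℕ :=
  sInf {n : ℕ | ∃ X ∈ C, ∃ Y ∈ D, n = dimExt1 S X Y}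

end Sums

section ExtHigher

variable {Q : Quiv}

/-- A representation of `Q` packaged with its dimension vector. -/
def PRp (Q : Quiv) := Σ γ : Q.V → ℕ, QRep Q γ

instance : Inhabited (PRp Q) := ⟨⟨fun _ => 0, fun _ => 0⟩⟩

/-- `K` is a (first) syzygy of `M` over `ℂQ/⟨S⟩`: there is a short exact sequence
`0 → K → P → M → 0` with `P` a projective module. -/
def IsSyzOf (S : Set (FormalRel Q)) (K M : PRp Q) : Prop :=
  K.2 ∈ modSet S K.1 ∧ ∃ (γP : Q.V → ℕ) (P : QRep Q γP), P ∈ modSet S γP ∧ IsProjRep S P ∧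
    ∃ i ∈ HomS K.2 P, ∃ p ∈ HomS P M.2, MorInj i ∧ MorSurj p ∧
      ∀ x, LinearMap.range (Matrix.mulVecLin (i x)) = LinearMap.ker (Matrix.mulVecLin (p x))

/-- A chosen syzygy of `M` over `ℂQ/⟨S⟩`. -/
def syz (S : Set (FormalRel Q)) (M : PRp Q) : PRp Q :=
  Classical.epsilon (fun K => IsSyzOf S K M)

/-- `dim_ℂ Ext^l (M,N)` over `ℂQ/⟨S⟩`, via dimension shifting along syzygies:
`Ext⁰ = Hom`, `Ext¹` is computed by cochains, and `Ext^{l+2}(M,N) = Ext^{l+1}(ΩM,N)`. -/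
def dimExtN (S : Set (FormalRel Q)) : ℕ → PRp Q → PRp Q → ℕ
  | 0, M, N => dimHom M.2 N.2
  | 1, M, N => dimExt1 S M.2 N.2
  | (l+2), M, N => dimExtN S (l+1) (syz S M) N

/-- The simple representation `S_x` concentrated at the vertex `x`. -/
def simplePR (Q : Quiv) (x0 : Q.V) : PRp Q :=
  ⟨fun z => if z = x0 then 1 else 0, fun _ => 0⟩

/-- The Euler form pairing `⟨α, dim S_y⟩_B` of the algebra `B = ℂQ/⟨S⟩`:
`Σ_{l ≥ 0} (−1)^l Σ_x dim Ext^l_B(S_x,S_y) · α(x)`.  The weight `⟨α,−⟩_B` is the function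
`y ↦ eulerPair S α y`. -/
def eulerPair (S : Set (FormalRel Q)) (α : Q.V → ℕ) (y : Q.V) : ℤ :=
  ∑ᶠ l : ℕ, (-1 : ℤ)^l *
    ∑ x : Q.V, (α x : ℤ) * (dimExtN S l (simplePR Q x) (simplePR Q y) : ℤ)

/-- The set of relations annihilating `W`: the annihilator `Ann_{ℂQ}(W)`, so that
`B = ℂQ/Ann_{ℂQ}(W)`. -/
def annRel {β : Q.V → ℕ} (W : QRep Q β) : Set (FormalRel Q) :=
  {r | evalLin W r.2.2 = 0}

/-- The weight semigroup `L_W` of `W`: weights `σ` with `σ|_{supp β} = ⟨α,−⟩_B` for some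
dimension vector `α ∈ ℕ^{supp β}` with `P_B(α) ≠ ∅`, where `B = ℂQ/Ann_{ℂQ}(W)`. -/
def weightSgrp {β : Q.V → ℕ} (W : QRep Q β) : Set (Q.V → ℤ) :=
  {σ | ∃ α : Q.V → ℕ, (∀ x, β x = 0 → α x = 0) ∧ (PAset (annRel W) α).Nonempty ∧
    ∀ y, β y ≠ 0 → σ y = eulerPair (annRel W) α y}

end ExtHigher

section Tame

variable {Q : Quiv}

/-- Specialization of a representation over `ℂ[x]` at `λ ∈ ℂ`, i.e.
`M ⊗_{ℂ[x]} ℂ[x]/(x−λ)`. -/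
def polyEvalAt {γ : Q.V → ℕ} (M : RepR Q (Polynomial ℂ) γ) (lam : ℂ) : QRep Q γ :=
  fun a => (M a).map (fun p => Polynomial.eval lam p)

/-- The algebra `A = ℂQ/⟨S⟩` is tame: for every dimension `d` there are finitely many
`A`–`ℂ[x]`-bimodules `M₁,…,M_s`, free of finite rank over `ℂ[x]` (i.e. matrix
representations over `ℂ[x]` satisfying the relations), such that all but finitely many
isomorphism classes of `d`-dimensional indecomposable `A`-modules are of the form
`M_i ⊗_{ℂ[x]} ℂ[x]/(x−λ)`. -/
def IsTame (S : Set (FormalRel Q)) : Prop :=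
  ∀ d : ℕ, ∃ (s : ℕ) (γs : Fin s → (Q.V → ℕ)) (M : ∀ i, RepR Q (Polynomial ℂ) (γs i)),
    (∀ i, ∀ r ∈ S, evalLinP (M i) r.2.2 = 0) ∧
    ∃ (t : ℕ) (βs : Fin t → (Q.V → ℕ)) (E : ∀ k, QRep Q (βs k)),
      ∀ (α : Q.V → ℕ) (V : QRep Q α), V ∈ modSet S α → (∑ x, α x) = d → IsIndecRep V →
        (∃ k, RIso (E k) V) ∨ (∃ i lam, RIso (polyEvalAt (M i) lam) V)

end Tame

section Stability

variable {Q : Quiv}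

/-- `U` is a subrepresentation of `V` (a family of subspaces preserved by the structure
maps). -/
def SubRep {α : Q.V → ℕ} (V : QRep Q α) (U : ∀ x : Q.V, Submodule ℂ (Fin (α x) → ℂ)) : Prop :=
  ∀ a : Q.A, (U (Q.t a)).map (Matrix.mulVecLin (V a)) ≤ U (Q.h a)

/-- `V` is `θ`-stable: `V ≠ 0`, `θ · dim V = 0`, and `θ · dim V' < 0` for every proper
nonzero subrepresentation `V'` of `V`. -/
def ThetaStable {α : Q.V → ℕ} (θ : Q.V → ℤ) (V : QRep Q α) : Prop :=
  (∃ x, α x ≠ 0) ∧ (∑ x, θ x * (α x : ℤ)) = 0 ∧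
  ∀ U : ∀ x : Q.V, Submodule ℂ (Fin (α x) → ℂ), SubRep V U →
    (∃ x, U x ≠ ⊥) → (∃ x, U x ≠ ⊤) →
      (∑ x, θ x * (Module.finrank ℂ (U x) : ℤ)) < 0

/-- The morphism with components `f` from `P` is essential onto its image: any
subrepresentation of `P` mapping onto the image of `f` is all of `P`. -/
def IsEssentialTo {γ δ : Q.V → ℕ} (P : QRep Q γ)
    (f : ∀ x : Q.V, Matrix (Fin (δ x)) (Fin (γ x)) ℂ) : Prop :=
  ∀ U : ∀ x : Q.V, Submodule ℂ (Fin (γ x) → ℂ), SubRep P U →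
    (∀ x, (U x).map (Matrix.mulVecLin (f x)) = LinearMap.range (Matrix.mulVecLin (f x))) →
      ∀ x, U x = ⊤

end Stability

section Ideal

variable {Q : Quiv}

/-- The `(x,y)`-component of the two-sided ideal `⟨S⟩` of `ℂQ` generated by the
relations in `S`: the span of the translates `q·r·p` of relations `r ∈ S` by paths. -/
def idealComp (S : Set (FormalRel Q)) (x y : Q.V) : Submodule ℂ (Quiver.Path x y →₀ ℂ) :=
  Submodule.span ℂ {c | ∃ r ∈ S, ∃ (p : Quiver.Path x r.1) (q : Quiver.Path r.2.1 y),
    c = Finsupp.mapDomain (fun s => (p.comp s).comp q) r.2.2}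

/-- `W` is a faithful module over `A = ℂQ/⟨S⟩`: every element of `ℂQ` annihilating `W`
lies in the ideal `⟨S⟩`. -/
def FaithfulOver (S : Set (FormalRel Q)) {β : Q.V → ℕ} (W : QRep Q β) : Prop :=
  ∀ (x y : Q.V) (c : Quiver.Path x y →₀ ℂ), evalLin W c = 0 → c ∈ idealComp S x y

end Ideal
section Precomp

variable {Q : Quiv}

/-- Precomposition with a morphism `f : L → M` of representations, as a linear map
`Hom(M,N) → Hom(L,N)`, `φ ↦ φ ∘ f`. -/
def precompMap {γ₁ γ₀ δ : Q.V → ℕ} (L : QRep Q γ₁) (M : QRep Q γ₀) (N : QRep Q δ)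
    (f : ∀ x : Q.V, Matrix (Fin (γ₀ x)) (Fin (γ₁ x)) ℂ) (hf : f ∈ HomS L M) :
    (HomS M N) →ₗ[ℂ] (HomS L N) where
  toFun φ := ⟨fun x => φ.1 x * f x, by
    intro a
    have h1 : φ.1 (Q.h a) * M a = N a * φ.1 (Q.t a) := φ.2 a
    have h2 : f (Q.h a) * L a = M a * f (Q.t a) := hf a
    calc (φ.1 (Q.h a) * f (Q.h a)) * L a
        = φ.1 (Q.h a) * (f (Q.h a) * L a) := by rw [Matrix.mul_assoc]
      _ = φ.1 (Q.h a) * (M a * f (Q.t a)) := by rw [h2]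
      _ = (φ.1 (Q.h a) * M a) * f (Q.t a) := by rw [Matrix.mul_assoc]
      _ = (N a * φ.1 (Q.t a)) * f (Q.t a) := by rw [h1]
      _ = N a * (φ.1 (Q.t a) * f (Q.t a)) := by rw [Matrix.mul_assoc]⟩
  map_add' φ ψ := by
    apply Subtype.ext
    funext x
    simp [Matrix.add_mul]
  map_smul' c φ := by
    apply Subtype.ext
    funext x
    simp [Matrix.smul_mul]

end Precomp

section BipartiteQsig

variable (Q : Quiv) (β : Q.V → ℕ) (σ : Q.V → ℤ)

/-- The bipartite quiver `Q^σ`: its vertices are the vertices of `Q` where `σ` is positive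
together with those where `σ` is negative, and it has one arrow `a_p : v_i → w_j` for every
oriented path `p` in `Q` from `v_i` to `w_j`. -/
def Qsig : Quiv where
  V := PosV Q σ ⊕ NegV Q σ
  A := Σ (i : PosV Q σ) (j : NegV Q σ), Quiver.Path i.1 j.1
  t := fun a => Sum.inl a.1
  h := fun a => Sum.inr a.2.1
  fV := inferInstance
  dV := inferInstance

/-- The dimension vector `β` restricted to `Q^σ`. -/
def betaSig : (Qsig Q σ).V → ℕ := Sum.elim (fun i => β i.1) (fun j => β j.1)

/-- The weight `σ` restricted to `Q^σ`. -/
def sigSig : (Qsig Q σ).V → ℤ := Sum.elim (fun i => σ i.1) (fun j => σ j.1)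

/-- The morphism `φ : rep(Q,β) → rep(Q^σ,β)` given by `φ(W)(a_p) = W(p)`. -/
def phiSig (W : QRep Q β) : QRep (Qsig Q σ) (betaSig Q β σ) :=
  fun a => evalPath W a.2.2

end BipartiteQsig
section SelfExt

open Filter Topology

variable {Q : Quiv}

/-- A representation regarded as a `1`-cochain. -/
abbrev toCochain {α : Q.V → ℕ} (V : QRep Q α) : C1sp (Q := Q) α α := fun a => V a

section ZariskiClosure

/-- The algebra of polynomial functions on `rep(Q,β)`. -/
def polyFunAlg (β : Q.V → ℕ) : Subalgebra ℂ (QRep Q β → ℂ) :=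
  AlgHom.range
    (AlgHom.pi (R := ℂ) (A := fun _ : QRep Q β => ℂ) fun W => MvPolynomial.aeval (repCoords W))

lemma coord_mem_polyFunAlg {β : Q.V → ℕ} (a : Q.A) (i : Fin (β (Q.h a)))
    (j : Fin (β (Q.t a))) : (fun W : QRep Q β => W a i j) ∈ polyFunAlg β :=
  ⟨MvPolynomial.X ⟨a, i, j⟩, by
    funext W
    exact MvPolynomial.aeval_X (repCoords W) _⟩

lemma eq_zero_on_zclosure {β : Q.V → ℕ} {F : QRep Q β → ℂ} (hF : F ∈ polyFunAlg β)
    {s : Set (QRep Q β)} (hs : ∀ W ∈ s, F W = 0) {W : QRep Q β} (hW : W ∈ zclosure s) :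
    F W = 0 := by
  obtain ⟨P, rfl⟩ := hF
  by_contra hne
  let _ := zarTop (Q := Q) β
  have hopen : IsOpen {W : QRep Q β | MvPolynomial.eval (repCoords W) P ≠ 0} := by
    let _ := zarPi (RepCoord (Q := Q) β)
    refine isOpen_induced_iff.2 ⟨{w | MvPolynomial.eval w P ≠ 0}, ?_, rfl⟩
    exact TopologicalSpace.isOpen_generateFrom_of_mem ⟨P, rfl⟩
  obtain ⟨W', hW', hmem⟩ := mem_closure_iff.1 hW _ hopen
    (by simpa [MvPolynomial.aeval_eq_eval] using hne)
  exact hW' (by simpa [MvPolynomial.aeval_eq_eval] using hs W' hmem)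

lemma subset_zclosure {β : Q.V → ℕ} (s : Set (QRep Q β)) : s ⊆ zclosure s :=
  @subset_closure _ (zarTop β) s

lemma linear_mem_polyFunAlg [Fintype Q.A] {α : Q.V → ℕ} (V : QRep Q α)
    (f : ∀ x : Q.V, Matrix (Fin (α x)) (Fin (α x)) ℂ) (T : C1sp (Q := Q) α α →ₗ[ℂ] ℂ) :
    (fun W : QRep Q α => T (d0map V W f)) ∈ polyFunAlg α := by
  classical
  have hT : ∀ u : C1sp (Q := Q) α α,
      T u = ∑ a, ∑ i, ∑ j, u a i j * T (Pi.single a (Matrix.single i j 1)) := by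
    intro u
    have hu : u = ∑ a, ∑ i, ∑ j, u a i j •
        (Pi.single a (Matrix.single i j 1) : C1sp (Q := Q) α α) := by
      conv_lhs => rw [← Finset.univ_sum_single u]
      refine Finset.sum_congr rfl fun a _ => ?_
      conv_lhs => rw [Matrix.matrix_eq_sum_single (u a)]
      rw [← LinearMap.single_apply (R := ℂ), map_sum]
      refine Finset.sum_congr rfl fun i _ => ?_
      rw [map_sum]
      refine Finset.sum_congr rfl fun j _ => ?_
      rw [LinearMap.single_apply, ← Pi.single_smul, Matrix.smul_single, smul_eq_mul, mul_one]
    conv_lhs => rw [hu]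
    simp only [map_sum, map_smul, smul_eq_mul]
  have hfun : (fun W : QRep Q α => T (d0map V W f)) =
      ∑ a, ∑ i, ∑ j, ((algebraMap ℂ (QRep Q α → ℂ) ((f (Q.h a) * V a) i j) -
        ∑ k, (fun W : QRep Q α => W a i k) * algebraMap ℂ (QRep Q α → ℂ) (f (Q.t a) k j)) *
          algebraMap ℂ (QRep Q α → ℂ) (T (Pi.single a (Matrix.single i j 1)))) := by
    funext W
    rw [hT]
    simp [d0map, Finset.sum_apply, Matrix.mul_apply]
  rw [hfun]
  refine Subalgebra.sum_mem _ fun a _ => Subalgebra.sum_mem _ fun i _ =>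
    Subalgebra.sum_mem _ fun j _ => Subalgebra.mul_mem _ (Subalgebra.sub_mem _
      (Subalgebra.algebraMap_mem _ _) (Subalgebra.sum_mem _ fun k _ =>
        Subalgebra.mul_mem _ (coord_mem_polyFunAlg a i k) (Subalgebra.algebraMap_mem _ _)))
      (Subalgebra.algebraMap_mem _ _)

lemma finrank_range_d0map_gAct_le [Fintype Q.A] {α : Q.V → ℕ} (V : QRep Q α) (g : GLb α) :
    Module.finrank ℂ (B1 V (gAct g V)) ≤ Module.finrank ℂ (B1 V V) := by
  let G : C1sp (Q := Q) α α →ₗ[ℂ] C1sp (Q := Q) α α :=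
    { toFun := fun u a => (g (Q.h a)).val * u a
      map_add' := fun u v => by funext a; simp [Matrix.mul_add]
      map_smul' := fun c u => by funext a; simp }
  have hle : B1 V (gAct g V) ≤ (B1 V V).map G := by
    rintro _ ⟨f, rfl⟩
    refine ⟨d0map V V (fun x => (g x)⁻¹.val * f x), ⟨_, rfl⟩, ?_⟩
    funext a
    have hg : (g (Q.h a)).val * (g (Q.h a))⁻¹.val = 1 := (g (Q.h a)).mul_inv
    change (g (Q.h a)).val * ((g (Q.h a))⁻¹.val * f (Q.h a) * V a -
      V a * ((g (Q.t a))⁻¹.val * f (Q.t a))) =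
      f (Q.h a) * V a - (g (Q.h a)).val * V a * (g (Q.t a))⁻¹.val * f (Q.t a)
    simp only [Matrix.mul_sub, ← Matrix.mul_assoc, hg, Matrix.one_mul]
  exact (Submodule.finrank_mono hle).trans (Submodule.finrank_map_le _ _)

/-- A tangent direction at `V` to a curve inside the orbit closure of `V` is a coboundary. -/
lemma tangent_mem_B1 [Fintype Q.A] {α : Q.V → ℕ} (V : QRep Q α)
    (c : ℂ → C1sp (Q := Q) α α) (u : C1sp (Q := Q) α α)
    (hc : ∀ᶠ t in 𝓝[≠] (0 : ℂ), (c t : QRep Q α) ∈ zclosure (orbitOf V))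
    (hu : Tendsto (fun t => t⁻¹ • (c t - toCochain V)) (𝓝[≠] 0) (𝓝 u)) :
    u ∈ B1 V V := by
  classical
  by_contra hnot
  set r := Module.finrank ℂ (B1 V V) with hr
  let b := Module.finBasis ℂ (B1 V V)
  choose f₀ hf₀ using fun j => (b j).2
  let w : Fin (r + 1) → C1sp (Q := Q) α α := Fin.cons u fun j => (b j : C1sp (Q := Q) α α)
  have hw : LinearIndependent ℂ w := by
    refine linearIndependent_finCons.2
      ⟨b.linearIndependent.map' (B1 V V).subtype (Submodule.ker_subtype _), fun h => hnot ?_⟩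
    refine Submodule.span_le.2 ?_ h
    rintro _ ⟨j, rfl⟩
    exact (b j).2
  obtain ⟨T, hT⟩ := LinearMap.exists_leftInverse_of_injective
    (Fintype.linearCombination ℂ w) (LinearMap.ker_eq_bot.2 hw.fintypeLinearCombination_injective)
  have hTw : ∀ j, T (w j) = Pi.single j 1 := fun j => by
    have := LinearMap.congr_fun hT (Pi.single j 1)
    simpa [Fintype.linearCombination_apply_single] using this
  let f : Fin (r + 1) → ∀ x : Q.V, Matrix (Fin (α x)) (Fin (α x)) ℂ :=
    Fin.cons (fun _ => 1) f₀
  let M : QRep Q α → Matrix (Fin (r + 1)) (Fin (r + 1)) ℂ :=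
    fun W => Matrix.of fun k j => T (d0map V W (f j)) k
  have hpoly : (fun W => (M W).det) ∈ polyFunAlg α := by
    have : (fun W => (M W).det) = ∑ σ : Equiv.Perm (Fin (r + 1)),
        (Equiv.Perm.sign σ : ℤ) • ∏ j, fun W : QRep Q α => T (d0map V W (f j)) (σ j) := by
      funext W
      simp [M, Matrix.det_apply, Finset.sum_apply, Units.smul_def]
    rw [this]
    exact Subalgebra.sum_mem _ fun σ _ => Subalgebra.zsmul_mem _
      (Subalgebra.prod_mem _ fun j _ =>
        linear_mem_polyFunAlg V (f j) ((LinearMap.proj (σ j)).comp T)) _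
  have horb : ∀ W ∈ orbitOf V, (M W).det = 0 := by
    rintro _ ⟨g, rfl⟩
    have hdep : ¬ LinearIndependent ℂ
        (fun j => (⟨d0map V (gAct g V) (f j), f j, rfl⟩ : B1 V (gAct g V))) := by
      intro h
      have h1 := h.fintype_card_le_finrank
      have h2 := finrank_range_d0map_gAct_le V g
      rw [Fintype.card_fin] at h1
      omega
    obtain ⟨a, ha, j, hj⟩ := Fintype.not_linearIndependent_iff.1 hdep
    refine Matrix.exists_mulVec_eq_zero_iff.1 ⟨a, fun h => hj (congrFun h j), ?_⟩
    have ha' : ∑ j, a j • d0map V (gAct g V) (f j) = 0 := by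
      have := congrArg (B1 V (gAct g V)).subtype ha
      simpa using this
    funext k
    have := congrFun (congrArg T ha') k
    simpa [M, Matrix.mulVec, dotProduct, mul_comm] using this
  let D : ℂ → C1sp (Q := Q) α α := fun t => t⁻¹ • (c t - toCochain V)
  let H : ℂ → Matrix (Fin (r + 1)) (Fin (r + 1)) ℂ := fun t => Matrix.of fun k j =>
    T (Fin.cons (α := fun _ => C1sp (Q := Q) α α) (D t)
      (fun j a => f₀ j (Q.h a) * V a - (V a + t • D t a) * f₀ j (Q.t a)) j) k
  have hTc : Continuous T := T.continuous_of_finiteDimensional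
  have hid : Tendsto (fun t : ℂ => t) (𝓝[≠] 0) (𝓝 0) := nhdsWithin_le_nhds
  have hlim : Tendsto H (𝓝[≠] 0) (𝓝 1) := by
    refine tendsto_pi_nhds.2 fun k => tendsto_pi_nhds.2 fun j => ?_
    have hone : (1 : Matrix (Fin (r + 1)) (Fin (r + 1)) ℂ) k j = T (w j) k := by
      rw [hTw, Matrix.one_apply, Pi.single_apply]
    rw [hone]
    refine ((continuous_apply k).tendsto _).comp ((hTc.tendsto _).comp ?_)
    refine Fin.cases ?_ (fun j => ?_) j
    · exact hu
    · have hwj : w j.succ = fun a => f₀ j (Q.h a) * V a -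
          (V a + (0 : ℂ) • u a) * f₀ j (Q.t a) := by
        simp only [w, Fin.cons_succ, zero_smul, add_zero]
        exact (hf₀ j).symm
      rw [hwj]
      simp only [Fin.cons_succ]
      refine tendsto_pi_nhds.2 fun a => tendsto_const_nhds.sub ?_
      have hDa : Tendsto (fun t => V a + t • D t a) (𝓝[≠] 0) (𝓝 (V a + (0 : ℂ) • u a)) :=
        tendsto_const_nhds.add (hid.smul (tendsto_pi_nhds.1 hu a))
      have hmul : Continuous fun X : Matrix (Fin (α (Q.h a))) (Fin (α (Q.t a))) ℂ =>
          X * f₀ j (Q.t a) := continuous_id.matrix_mul continuous_const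
      exact (hmul.tendsto _).comp hDa
  have hdet : Tendsto (fun t => (H t).det) (𝓝[≠] 0) (𝓝 1) := by
    have hcont : Continuous fun X : Matrix (Fin (r + 1)) (Fin (r + 1)) ℂ => X.det :=
      continuous_id.matrix_det
    simpa [Function.comp_def] using (hcont.tendsto 1).comp hlim
  have hzero : ∀ᶠ t in 𝓝[≠] (0 : ℂ), (H t).det = 0 := by
    filter_upwards [hc, self_mem_nhdsWithin] with t ht ht0
    have ht0' : t ≠ 0 := ht0
    have hct : ∀ a, V a + t • D t a = c t a := by
      intro a
      simp only [D, Pi.smul_apply, Pi.sub_apply, smul_smul, mul_inv_cancel₀ ht0', one_smul]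
      exact add_sub_cancel _ _
    have hM : M (c t) = H t * Matrix.diagonal (Fin.cons (-t) fun _ => 1) := by
      ext k j
      rw [Matrix.mul_diagonal]
      refine Fin.cases ?_ (fun j => ?_) j
      · have : d0map V (c t) (f 0) = (-t) • D t := by
          funext a
          simp only [d0map, f, Fin.cons_zero, LinearMap.coe_mk, AddHom.coe_mk, Matrix.one_mul,
            Matrix.mul_one, Pi.smul_apply, neg_smul, ← hct]
          abel
        simp only [M, H, Matrix.of_apply, this, Fin.cons_zero, map_smul, Pi.smul_apply,
          smul_eq_mul]
        ring
      · simp only [M, H, Matrix.of_apply, Fin.cons_succ, mul_one, hct, f]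
        rfl
    have h0 := eq_zero_on_zclosure hpoly horb ht
    simp only [hM, Matrix.det_mul, Matrix.det_diagonal, Fin.prod_univ_succ, Fin.cons_zero,
      Fin.cons_succ, Finset.prod_const_one, mul_one] at h0
    exact (mul_eq_zero.1 h0).resolve_right (neg_ne_zero.2 ht0')
  exact one_ne_zero
    (tendsto_nhds_unique ((tendsto_congr' hzero).1 hdet) tendsto_const_nhds)

end ZariskiClosure

section Extension

variable {α : Q.V → ℕ}

/-- The self-extension of `V` attached to a `1`-cochain `φ`. -/
def extRep (V : QRep Q α) (φ : C1sp (Q := Q) α α) : QRep Q (fun x => α x + α x) :=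
  fun a => Matrix.reindex finSumFinEquiv finSumFinEquiv (Matrix.fromBlocks (V a) (φ a) 0 (V a))

lemma castM_reindex_fromBlocks {m n m' n' : ℕ} (hm : m = m') (hn : n = n')
    (A B C D : Matrix (Fin m) (Fin n) ℂ) :
    castM (congrArg (fun k => k + k) hm) (congrArg (fun k => k + k) hn)
      (Matrix.reindex finSumFinEquiv finSumFinEquiv (Matrix.fromBlocks A B C D)) =
    Matrix.reindex finSumFinEquiv finSumFinEquiv
      (Matrix.fromBlocks (castM hm hn A) (castM hm hn B) (castM hm hn C) (castM hm hn D)) := by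
  subst hm hn
  rfl

lemma evalPath_extRep (V : QRep Q α) (φ : C1sp (Q := Q) α α) {x y : Q.V}
    (p : Quiver.Path x y) :
    evalPath (extRep V φ) p = Matrix.reindex finSumFinEquiv finSumFinEquiv
      (Matrix.fromBlocks (evalPath V p) (der V V φ p) 0 (evalPath V p)) := by
  induction p with
  | nil => simp [evalPath, der]
  | cons p e ih =>
    have h := castM_reindex_fromBlocks (congrArg α e.2.2) (congrArg α e.2.1)
      (V e.1) (φ e.1) 0 (V e.1)
    have h0 : castM (congrArg α e.2.2) (congrArg α e.2.1)
      (0 : Matrix (Fin (α (Q.h e.1))) (Fin (α (Q.t e.1))) ℂ) = 0 := rfl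
    have hE : castM (congrArg (fun x => α x + α x) e.2.2) (congrArg (fun x => α x + α x) e.2.1)
      (extRep V φ e.1) = _ := h
    rw [evalPath, ih, hE, h0, evalPath, der, Matrix.reindex_apply, Matrix.reindex_apply,
      Matrix.submatrix_mul_equiv, Matrix.fromBlocks_multiply]
    simp only [Matrix.mul_zero, add_zero, Matrix.zero_mul, zero_add]
    rw [add_comm (castM _ _ (V e.1) * der V V φ p), Matrix.reindex_apply]

lemma evalLin_extRep (V : QRep Q α) (φ : C1sp (Q := Q) α α) {x y : Q.V}
    (c : Quiver.Path x y →₀ ℂ) :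
    evalLin (extRep V φ) c = Matrix.reindex finSumFinEquiv finSumFinEquiv
      (Matrix.fromBlocks (evalLin V c) (derRel V V φ c) 0 (evalLin V c)) := by
  classical
  simp only [evalLin, derRel, Finsupp.sum, evalPath_extRep]
  induction c.support using Finset.induction_on with
  | empty => simp
  | insert p s hp ih =>
    have hsmul : ∀ A B : Matrix (Fin (α y)) (Fin (α x)) ℂ,
        c p • (Matrix.fromBlocks A B 0 A).submatrix finSumFinEquiv.symm finSumFinEquiv.symm =
        (Matrix.fromBlocks (c p • A) (c p • B) 0 (c p • A)).submatrix
          (finSumFinEquiv (m := α y)).symm (finSumFinEquiv (m := α x)).symm := by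
      intro A B
      rw [← smul_zero (c p), ← Matrix.fromBlocks_smul, smul_zero]
      rfl
    have hadd : ∀ A B A' B' : Matrix (Fin (α y)) (Fin (α x)) ℂ,
        (Matrix.fromBlocks A B 0 A).submatrix finSumFinEquiv.symm finSumFinEquiv.symm +
        (Matrix.fromBlocks A' B' 0 A').submatrix finSumFinEquiv.symm finSumFinEquiv.symm =
        (Matrix.fromBlocks (A + A') (B + B') 0 (A + A')).submatrix
          (finSumFinEquiv (m := α y)).symm (finSumFinEquiv (m := α x)).symm := by
      intro A B A' B'
      rw [← add_zero (0 : Matrix (Fin (α y)) (Fin (α x)) ℂ), ← Matrix.fromBlocks_add, add_zero]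
      rfl
    simp only [Finset.sum_insert hp, ih]
    simp only [Matrix.reindex_apply, hsmul]
    exact hadd _ _ _ _

lemma extRep_mem_modSet {R : Set (FormalRel Q)} {V : QRep Q α} (hV : V ∈ modSet R α)
    {φ : C1sp (Q := Q) α α} (hφ : φ ∈ Z1 R V V) :
    extRep V φ ∈ modSet R (fun x => α x + α x) := by
  intro r hr
  rw [evalLin_extRep, hV r hr, hφ r hr]
  simp

/-- A morphism from a projective onto `V` extends to a derivation-like family along a
`1`-cocycle. -/
lemma exists_twisted_lift {R : Set (FormalRel Q)} {V : QRep Q α} (hV : V ∈ modSet R α)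
    {φ : C1sp (Q := Q) α α} (hφ : φ ∈ Z1 R V V) {γ : Q.V → ℕ} {P : QRep Q γ}
    (hP : IsProjRep R P) {p : ∀ x : Q.V, Matrix (Fin (α x)) (Fin (γ x)) ℂ}
    (hp : p ∈ HomS P V) :
    ∃ q : ∀ x : Q.V, Matrix (Fin (α x)) (Fin (γ x)) ℂ,
      ∀ a, q (Q.h a) * P a = V a * q (Q.t a) + φ a * p (Q.t a) := by
  let g : ∀ x : Q.V, Matrix (Fin (α x)) (Fin (α x + α x)) ℂ := fun x =>
    (Matrix.fromCols (0 : Matrix (Fin (α x)) (Fin (α x)) ℂ) 1).submatrix id finSumFinEquiv.symm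
  let k : ∀ x : Q.V, Matrix (Fin (α x)) (Fin (α x + α x)) ℂ := fun x =>
    (Matrix.fromCols (1 : Matrix (Fin (α x)) (Fin (α x)) ℂ) 0).submatrix id finSumFinEquiv.symm
  have hg : g ∈ HomS (extRep V φ) V := by
    intro a
    simp only [g, extRep, Matrix.reindex_apply]
    rw [Matrix.submatrix_mul_equiv, Matrix.fromCols_mul_fromBlocks]
    ext i j
    obtain ⟨j, rfl⟩ := finSumFinEquiv.surjective j
    cases j <;> simp [Matrix.mul_apply, Matrix.one_apply, -finSumFinEquiv_apply_left,
      -finSumFinEquiv_apply_right]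
  have hk : ∀ a, k (Q.h a) * extRep V φ a = V a * k (Q.t a) + φ a * g (Q.t a) := by
    intro a
    simp only [g, k, extRep, Matrix.reindex_apply]
    rw [Matrix.submatrix_mul_equiv, Matrix.fromCols_mul_fromBlocks]
    ext i j
    obtain ⟨j, rfl⟩ := finSumFinEquiv.surjective j
    cases j <;> simp [Matrix.mul_apply, Matrix.one_apply, -finSumFinEquiv_apply_left,
      -finSumFinEquiv_apply_right]
  have hsurj : MorSurj g := by
    intro x v
    refine ⟨fun i => Sum.elim 0 v (finSumFinEquiv.symm i), ?_⟩
    funext i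
    simp only [Matrix.mulVecLin_apply, Matrix.mulVec, dotProduct, g]
    rw [← finSumFinEquiv.sum_comp]
    simp [Matrix.one_apply]
  obtain ⟨h, hh, hgh⟩ := hP _ _ _ _ (extRep_mem_modSet hV hφ) hV g hg hsurj p hp
  refine ⟨fun x => k x * h x, fun a => ?_⟩
  rw [Matrix.mul_assoc, hh a, ← Matrix.mul_assoc, hk, Matrix.add_mul, Matrix.mul_assoc,
    Matrix.mul_assoc, hgh]

end Extension

section Quotient

lemma evalPath_intertwine {β γ : Q.V → ℕ} {P : QRep Q β} {W : QRep Q γ}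
    {p : ∀ x : Q.V, Matrix (Fin (γ x)) (Fin (β x)) ℂ} (hp : p ∈ HomS P W) {x y : Q.V}
    (s : Quiver.Path x y) : p y * evalPath P s = evalPath W s * p x := by
  induction s with
  | nil => simp [evalPath]
  | cons s e ih =>
    have he : ∀ {u v : Q.V} (e : u ⟶ v), p v * castM (congrArg β e.2.2) (congrArg β e.2.1)
        (P e.1) = castM (congrArg γ e.2.2) (congrArg γ e.2.1) (W e.1) * p u := by
      rintro _ _ ⟨a, rfl, rfl⟩
      exact hp a
    rw [evalPath, evalPath, ← Matrix.mul_assoc, he, Matrix.mul_assoc, ih, Matrix.mul_assoc]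

lemma mem_modSet_of_morSurj {R : Set (FormalRel Q)} {β γ : Q.V → ℕ} {P : QRep Q β}
    {W : QRep Q γ} (hP : P ∈ modSet R β)
    {p : ∀ x : Q.V, Matrix (Fin (γ x)) (Fin (β x)) ℂ} (hp : p ∈ HomS P W) (hs : MorSurj p) :
    W ∈ modSet R γ := by
  rintro ⟨x, y, c⟩ hr
  have h0 : evalLin W c * p x = 0 := by
    have hPc : evalLin P c = 0 := hP _ hr
    rw [← Matrix.mul_zero (p y), ← hPc]
    simp only [evalLin, Finsupp.sum, Matrix.sum_mul, Matrix.mul_sum, Matrix.smul_mul,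
      Matrix.mul_smul, evalPath_intertwine hp]
  change evalLin W c = 0
  apply Matrix.mulVec_injective
  funext v
  obtain ⟨w, rfl⟩ := hs x v
  rw [Matrix.mulVecLin_apply, Matrix.mulVec_mulVec, h0]
  simp

end Quotient

section Splitting

lemma exists_matrix_splitting {k m n : ℕ} (i : Matrix (Fin m) (Fin k) ℂ)
    (p : Matrix (Fin n) (Fin m) ℂ) (hi : Function.Injective i.mulVecLin)
    (hp : Function.Surjective p.mulVecLin)
    (he : LinearMap.range i.mulVecLin = LinearMap.ker p.mulVecLin) :
    ∃ (s : Matrix (Fin m) (Fin n) ℂ) (r : Matrix (Fin k) (Fin m) ℂ),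
      p * s = 1 ∧ p * i = 0 ∧ r * i = 1 ∧ i * r = 1 - s * p := by
  obtain ⟨s', hs'⟩ := LinearMap.exists_rightInverse_of_surjective p.mulVecLin
    (LinearMap.range_eq_top.2 hp)
  obtain ⟨l', hl'⟩ := LinearMap.exists_leftInverse_of_injective i.mulVecLin
    (LinearMap.ker_eq_bot.2 hi)
  obtain ⟨s, rfl⟩ : ∃ s, Matrix.mulVecLin s = s' := ⟨_, Matrix.toLin'_toMatrix' s'⟩
  obtain ⟨l, rfl⟩ : ∃ l, Matrix.mulVecLin l = l' := ⟨_, Matrix.toLin'_toMatrix' l'⟩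
  have hps : p * s = 1 := Matrix.toLin'.injective (by
    rw [Matrix.toLin'_mul, Matrix.toLin'_one]; exact hs')
  have hli : l * i = 1 := Matrix.toLin'.injective (by
    rw [Matrix.toLin'_mul, Matrix.toLin'_one]; exact hl')
  have hpi : p * i = 0 := by
    apply Matrix.mulVec_injective
    funext v
    have : i.mulVecLin v ∈ LinearMap.ker p.mulVecLin := he ▸ ⟨v, rfl⟩
    simpa using this
  refine ⟨s, l * (1 - s * p), hps, hpi, ?_, ?_⟩
  · rw [Matrix.mul_assoc, Matrix.sub_mul, Matrix.mul_assoc, hpi, Matrix.mul_zero, sub_zero,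
      Matrix.one_mul, hli]
  · apply Matrix.mulVec_injective
    funext v
    have hker : (1 - s * p).mulVec v ∈ LinearMap.ker p.mulVecLin := by
      rw [LinearMap.mem_ker, Matrix.mulVecLin_apply, Matrix.mulVec_mulVec, Matrix.mul_sub,
        ← Matrix.mul_assoc, hps, Matrix.mul_one, Matrix.one_mul, sub_self, Matrix.zero_mulVec]
    rw [← he] at hker
    obtain ⟨w, hw⟩ := hker
    rw [Matrix.mulVecLin_apply] at hw
    rw [← Matrix.mulVec_mulVec, ← Matrix.mulVec_mulVec, ← hw, Matrix.mulVec_mulVec w l i, hli,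
      Matrix.one_mulVec]

end Splitting

/-- A perturbation of the first map of a projective presentation has cokernel in `P_A(α)`. -/
lemma perturbed_cokernel_mem_PAset {R : Set (FormalRel Q)} {α γ₀ γ₁ : Q.V → ℕ}
    {P₀ : QRep Q γ₀} {P₁ : QRep Q γ₁} (hP₀ : P₀ ∈ modSet R γ₀) (hP₁ : P₁ ∈ modSet R γ₁)
    (hproj₀ : IsProjRep R P₀) (hproj₁ : IsProjRep R P₁)
    {i : ∀ x : Q.V, Matrix (Fin (γ₀ x)) (Fin (γ₁ x)) ℂ}
    {p : ∀ x : Q.V, Matrix (Fin (α x)) (Fin (γ₀ x)) ℂ}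
    (hinj : MorInj i) (hsurj : MorSurj p)
    (hex : ∀ x, LinearMap.range (i x).mulVecLin = LinearMap.ker (p x).mulVecLin)
    {s : ∀ x : Q.V, Matrix (Fin (γ₀ x)) (Fin (α x)) ℂ}
    {r : ∀ x : Q.V, Matrix (Fin (γ₁ x)) (Fin (γ₀ x)) ℂ}
    (hpi : ∀ x, p x * i x = 0) (hir : ∀ x, i x * r x = 1 - s x * p x)
    {Θ Θ' : ∀ x : Q.V, Matrix (Fin (γ₀ x)) (Fin (γ₀ x)) ℂ}
    (h₁ : ∀ x, Θ x * Θ' x = 1) (h₂ : ∀ x, Θ' x * Θ x = 1)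
    (hs : ∀ x, Θ x * s x = s x) (hΘ : (fun x => Θ x * i x) ∈ HomS P₁ P₀) :
    (fun a => p (Q.h a) * Θ' (Q.h a) * P₀ a * s (Q.t a) : QRep Q α) ∈ PAset R α := by
  have hsplit : ∀ x, s x * (p x * Θ' x) = 1 - Θ x * i x * (r x * Θ' x) := by
    intro x
    have : Θ x * i x * (r x * Θ' x) = Θ x * (i x * r x) * Θ' x := by
      simp only [Matrix.mul_assoc]
    rw [this, hir, Matrix.mul_sub, Matrix.sub_mul, Matrix.mul_one, h₁, ← Matrix.mul_assoc (Θ x),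
      hs, sub_sub_cancel, Matrix.mul_assoc]
  have hp' : (fun x => p x * Θ' x) ∈
      HomS P₀ (fun a => p (Q.h a) * Θ' (Q.h a) * P₀ a * s (Q.t a) : QRep Q α) := by
    intro a
    have hΘa : Θ (Q.h a) * i (Q.h a) * P₁ a = P₀ a * (Θ (Q.t a) * i (Q.t a)) := hΘ a
    have hkill : p (Q.h a) * Θ' (Q.h a) * (P₀ a * (Θ (Q.t a) * i (Q.t a))) = 0 := by
      rw [← hΘa]
      calc p (Q.h a) * Θ' (Q.h a) * (Θ (Q.h a) * i (Q.h a) * P₁ a)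
          = p (Q.h a) * (Θ' (Q.h a) * Θ (Q.h a)) * i (Q.h a) * P₁ a := by
            simp only [Matrix.mul_assoc]
        _ = 0 := by rw [h₂, Matrix.mul_one, hpi, Matrix.zero_mul]
    change p (Q.h a) * Θ' (Q.h a) * P₀ a =
      p (Q.h a) * Θ' (Q.h a) * P₀ a * s (Q.t a) * (p (Q.t a) * Θ' (Q.t a))
    rw [Matrix.mul_assoc _ (s (Q.t a)), hsplit, Matrix.mul_sub, Matrix.mul_one,
      ← Matrix.mul_assoc _ (Θ (Q.t a) * i (Q.t a)), Matrix.mul_assoc _ (P₀ a), hkill,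
      Matrix.zero_mul, sub_zero]
  have hsurj' : MorSurj fun x => p x * Θ' x := by
    intro x v
    obtain ⟨w, rfl⟩ := hsurj x v
    refine ⟨(Θ x).mulVec w, ?_⟩
    rw [Matrix.mulVecLin_apply, Matrix.mulVec_mulVec, Matrix.mul_assoc, h₂, Matrix.mul_one,
      Matrix.mulVecLin_apply]
  refine ⟨mem_modSet_of_morSurj hP₀ hp' hsurj', γ₀, γ₁, P₀, P₁, hP₀, hP₁, hproj₀, hproj₁,
    _, hΘ, _, hp', ?_, hsurj', ?_⟩
  · intro x v w hvw
    apply hinj x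
    have := congrArg (Θ' x).mulVec hvw
    simpa only [Matrix.mulVecLin_apply, Matrix.mulVec_mulVec, ← Matrix.mul_assoc, h₂,
      Matrix.one_mul] using this
  · intro x
    ext v
    rw [LinearMap.mem_ker, Matrix.mulVecLin_apply, ← Matrix.mulVec_mulVec,
      ← Matrix.mulVecLin_apply (p x), ← LinearMap.mem_ker, ← hex x]
    constructor
    · rintro ⟨w, rfl⟩
      refine ⟨w, ?_⟩
      rw [Matrix.mulVecLin_apply, Matrix.mulVecLin_apply, Matrix.mulVec_mulVec,
        ← Matrix.mul_assoc, h₂, Matrix.one_mul]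
    · rintro ⟨w, hw⟩
      refine ⟨w, ?_⟩
      rw [Matrix.mulVecLin_apply] at hw ⊢
      rw [← Matrix.mulVec_mulVec, hw, Matrix.mulVec_mulVec, h₁, Matrix.one_mulVec]

/-- The inverse of `1 - t X` is continuous at `t = 0`. -/
lemma tendsto_inv_one_sub_smul {n : ℕ} (X : Matrix (Fin n) (Fin n) ℂ) :
    (∀ᶠ t in 𝓝[≠] (0 : ℂ), IsUnit (1 - t • X).det) ∧
      Tendsto (fun t : ℂ => (1 - t • X)⁻¹) (𝓝[≠] 0) (𝓝 1) := by
  have hc : Continuous fun t : ℂ => 1 - t • X := by fun_prop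
  have hd : Tendsto (fun t : ℂ => (1 - t • X).det) (𝓝[≠] 0) (𝓝 1) := by
    simpa using (hc.matrix_det.tendsto 0).mono_left (nhdsWithin_le_nhds (s := {0}ᶜ))
  have ha : Tendsto (fun t : ℂ => (1 - t • X).adjugate) (𝓝[≠] 0) (𝓝 1) := by
    simpa using (hc.matrix_adjugate.tendsto 0).mono_left (nhdsWithin_le_nhds (s := {0}ᶜ))
  refine ⟨(hd.eventually_ne one_ne_zero).mono fun t ht => isUnit_iff_ne_zero.2 ht, ?_⟩
  simpa [Matrix.inv_def] using (hd.inv₀ one_ne_zero).smul ha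

/-- Every `1`-cocycle of a module of projective dimension at most one is, up to a coboundary,
tangent to a curve in `P_A(α)`. -/
lemma exists_curve_tangent {R : Set (FormalRel Q)} {α : Q.V → ℕ} {V : QRep Q α}
    (hV : V ∈ PAset R α) {φ : C1sp (Q := Q) α α} (hφ : φ ∈ Z1 R V V) :
    ∃ (c : ℂ → C1sp (Q := Q) α α) (f : ∀ x : Q.V, Matrix (Fin (α x)) (Fin (α x)) ℂ),
      (∀ᶠ t in 𝓝[≠] (0 : ℂ), (c t : QRep Q α) ∈ PAset R α) ∧
      Tendsto (fun t => t⁻¹ • (c t - toCochain V)) (𝓝[≠] 0)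
        (𝓝 (φ - d0map V V f)) := by
  obtain ⟨hVmod, γ₀, γ₁, P₀, P₁, hP₀, hP₁, hproj₀, hproj₁, i, hi, p, hp, hinj, hsurj, hex⟩ := hV
  choose s r hps hpi hri hir using fun x =>
    exists_matrix_splitting (i x) (p x) (hinj x) (hsurj x) (hex x)
  obtain ⟨q, hq⟩ := exists_twisted_lift hVmod hφ hproj₀ hp
  have hqi : (fun x => q x * i x) ∈ HomS P₁ V := by
    intro a
    change q (Q.h a) * i (Q.h a) * P₁ a = V a * (q (Q.t a) * i (Q.t a))
    rw [Matrix.mul_assoc, hi a, ← Matrix.mul_assoc, hq, Matrix.add_mul, Matrix.mul_assoc,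
      Matrix.mul_assoc, hpi, Matrix.mul_zero, add_zero]
  obtain ⟨ψ, hψ, hpψ⟩ := hproj₁ _ _ _ _ hP₀ hVmod p hp hsurj _ hqi
  have hrs : ∀ x, r x * s x = 0 := by
    intro x
    have : i x * (r x * s x) = 0 := by
      rw [← Matrix.mul_assoc, hir, Matrix.sub_mul, Matrix.mul_assoc, hps, Matrix.mul_one,
        Matrix.one_mul, sub_self]
    calc r x * s x = r x * i x * (r x * s x) := by rw [hri, Matrix.one_mul]
      _ = 0 := by rw [Matrix.mul_assoc, this, Matrix.mul_zero]
  let Θ : ℂ → ∀ x : Q.V, Matrix (Fin (γ₀ x)) (Fin (γ₀ x)) ℂ :=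
    fun t x => 1 - t • (ψ x * r x)
  have hunit : ∀ᶠ t in 𝓝[≠] (0 : ℂ), ∀ x, IsUnit (Θ t x).det :=
    eventually_all.2 fun x => (tendsto_inv_one_sub_smul (ψ x * r x)).1
  have hinv : ∀ x, Tendsto (fun t => (Θ t x)⁻¹) (𝓝[≠] 0) (𝓝 1) := fun x =>
    (tendsto_inv_one_sub_smul (ψ x * r x)).2
  refine ⟨fun t a => p (Q.h a) * (Θ t (Q.h a))⁻¹ * P₀ a * s (Q.t a), fun x => q x * s x, ?_, ?_⟩
  · filter_upwards [hunit] with t ht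
    refine perturbed_cokernel_mem_PAset (s := s) (r := r) (Θ := Θ t)
      (Θ' := fun x => (Θ t x)⁻¹) hP₀ hP₁ hproj₀ hproj₁ hinj hsurj hex hpi hir
      (fun x => Matrix.mul_nonsing_inv _ (ht x)) (fun x => Matrix.nonsing_inv_mul _ (ht x)) ?_ ?_
    · intro x
      simp only [Θ, Matrix.sub_mul, Matrix.smul_mul, Matrix.mul_assoc, hrs, Matrix.mul_zero,
        smul_zero, Matrix.one_mul, sub_zero]
    · have : (fun x => Θ t x * i x) = i - t • ψ := by
        funext x
        simp only [Θ, Matrix.sub_mul, Matrix.smul_mul, Matrix.mul_assoc, hri, Matrix.mul_one,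
          Matrix.one_mul, Pi.sub_apply, Pi.smul_apply]
      rw [this]
      exact Submodule.sub_mem _ hi (Submodule.smul_mem _ _ hψ)
  · refine tendsto_pi_nhds.2 fun a => ?_
    have hpa : p (Q.h a) * P₀ a = V a * p (Q.t a) := hp a
    have hVa : V a = p (Q.h a) * P₀ a * s (Q.t a) := by
      rw [hpa, Matrix.mul_assoc, hps, Matrix.mul_one]
    have hlim : (φ - d0map V V (fun x => q x * s x)) a =
        p (Q.h a) * (1 : Matrix (Fin (γ₀ (Q.h a))) (Fin (γ₀ (Q.h a))) ℂ) *
          (ψ (Q.h a) * r (Q.h a)) * P₀ a * s (Q.t a) := by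
      have e : p (Q.h a) * (1 : Matrix (Fin (γ₀ (Q.h a))) (Fin (γ₀ (Q.h a))) ℂ) *
          (ψ (Q.h a) * r (Q.h a)) = q (Q.h a) * (1 - s (Q.h a) * p (Q.h a)) := by
        rw [Matrix.mul_one, ← Matrix.mul_assoc, hpψ, Matrix.mul_assoc, hir]
      rw [e, Matrix.mul_sub, Matrix.sub_mul, Matrix.sub_mul, Matrix.mul_one, hq, Matrix.add_mul,
        Matrix.mul_assoc (φ a), hps, Matrix.mul_one]
      have e' : q (Q.h a) * (s (Q.h a) * p (Q.h a)) * P₀ a * s (Q.t a) =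
          q (Q.h a) * s (Q.h a) * V a := by
        rw [hVa]
        simp only [Matrix.mul_assoc]
      rw [e']
      simp only [d0map, LinearMap.coe_mk, AddHom.coe_mk, Pi.sub_apply, Matrix.mul_assoc]
      abel
    rw [hlim]
    have hcont : Continuous fun X : Matrix (Fin (γ₀ (Q.h a))) (Fin (γ₀ (Q.h a))) ℂ =>
        p (Q.h a) * X * (ψ (Q.h a) * r (Q.h a)) * P₀ a * s (Q.t a) := by fun_prop
    refine ((hcont.tendsto 1).comp (hinv (Q.h a))).congr' ?_
    filter_upwards [hunit, self_mem_nhdsWithin] with t ht ht0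
    have ht0' : t ≠ 0 := ht0
    have hΘ : (Θ t (Q.h a))⁻¹ - 1 = t • ((Θ t (Q.h a))⁻¹ * (ψ (Q.h a) * r (Q.h a))) := by
      have h1 := Matrix.nonsing_inv_mul _ (ht (Q.h a))
      have h2 : (Θ t (Q.h a))⁻¹ * Θ t (Q.h a) =
          (Θ t (Q.h a))⁻¹ - t • ((Θ t (Q.h a))⁻¹ * (ψ (Q.h a) * r (Q.h a))) := by
        conv_lhs => rw [show Θ t (Q.h a) = 1 - t • (ψ (Q.h a) * r (Q.h a)) from rfl]
        rw [Matrix.mul_sub, Matrix.mul_one, Matrix.mul_smul]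
      rw [← h1, h2, sub_sub_cancel]
    have hsub : p (Q.h a) * (Θ t (Q.h a))⁻¹ * P₀ a * s (Q.t a) - V a =
        t • (p (Q.h a) * (Θ t (Q.h a))⁻¹ * (ψ (Q.h a) * r (Q.h a)) * P₀ a * s (Q.t a)) := by
      rw [hVa, ← Matrix.sub_mul, ← Matrix.sub_mul]
      conv_lhs => rw [show p (Q.h a) * (Θ t (Q.h a))⁻¹ - p (Q.h a) =
        p (Q.h a) * ((Θ t (Q.h a))⁻¹ - 1) by rw [Matrix.mul_sub, Matrix.mul_one], hΘ]
      simp only [Matrix.mul_smul, Matrix.smul_mul, Matrix.mul_assoc]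
    change _ = t⁻¹ • (p (Q.h a) * (Θ t (Q.h a))⁻¹ * P₀ a * s (Q.t a) - V a)
    rw [hsub, smul_smul, inv_mul_cancel₀ ht0', one_smul]
    rfl

end SelfExt

/-- Let `A = ℂQ/⟨R⟩` be an acyclic bound quiver algebra and `α` a
dimension vector with `P_A(α) ≠ ∅`.  If `C(α)` is an orbit closure,
`C(α) = closure(GL(α)·V)` for some `V ∈ P_A(α)`, then `Ext¹_A(V,V) = 0`; in particular
`ext¹_A(C(α),C(α)) = 0`. -/
theorem statement11 (Q : Quiv) [Fintype Q.A] (hconn : QConnected Q) (hacyc : QAcyclic Q)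
    (R : Set (FormalRel Q)) (hRfin : R.Finite) (hRadm : AdmissibleRels R)
    (α : Q.V → ℕ) (hne : (PAset R α).Nonempty)
    (V : QRep Q α) (hV : V ∈ PAset R α)
    (horb : Cset R α = zclosure (orbitOf V)) :
    dimExt1 R V V = 0 ∧ genExt1 R (Cset R α) (Cset R α) = 0 := by
  have hle : Z1 R V V ≤ B1 V V := by
    intro φ hφ
    obtain ⟨c, f, hc, htan⟩ := exists_curve_tangent hV hφ
    have hmem := tangent_mem_B1 V c _
      (hc.mono fun t ht => horb ▸ subset_zclosure (PAset R α) ht) htan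
    have := Submodule.add_mem _ hmem (⟨f, rfl⟩ : d0map V V f ∈ B1 V V)
    rwa [sub_add_cancel] at this
  have hext : dimExt1 R V V = 0 := by
    rw [dimExt1, inf_eq_right.2 hle, Nat.sub_self]
  refine ⟨hext, Nat.le_zero.1 (Nat.sInf_le ?_)⟩
  exact ⟨V, subset_zclosure _ hV, V, subset_zclosure _ hV, hext.symm⟩
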